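/- arXiv:2304.05366 — 7 statements merged into one kernel-verified Lean document; each statement's English description precedes it below -/
import Mathlib

section
/- Let n be a natural number, let d : List Bool → Option (List Bool) be a description system for bitstrings, and let x be drawn uniformly at random from the 2^n bitstrings of length n. Then for every natural number k ≤ n, the probability that K_d(x) ≤ n − k is at most 2^(1−k). -/
/-- The bitstrings of length at most `m` inject into the disjoint union of the bitstrings of
each length `i ≤ m`. -/
def boundedBitstringToSigma (m : ℕ) (s : {s : List Bool // s.length ≤ m}) :
    Σ i : Fin (m + 1), List.Vector Bool i :=
  ⟨⟨s.val.length, Nat.lt_succ_of_le s.property⟩, ⟨s.val, rfl⟩⟩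

theorem boundedBitstringToSigma_injective (m : ℕ) :
    Function.Injective (boundedBitstringToSigma m) := fun _ _ h =>
  Subtype.ext (congrArg (fun p : Σ i : Fin (m + 1), List.Vector Bool i => p.2.toList) h)

instance finite_boundedBitstring (m : ℕ) : Finite {s : List Bool // s.length ≤ m} :=
  Finite.of_injective _ (boundedBitstringToSigma_injective m)

/-- There are fewer than `2 ^ (m + 1)` bitstrings of length at most `m`. -/
theorem card_boundedBitstring_lt (m : ℕ) :
    Nat.card {s : List Bool // s.length ≤ m} < 2 ^ (m + 1) := by
  refine (Nat.card_le_card_of_injective _ (boundedBitstringToSigma_injective m)).trans_lt ?_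
  rw [Nat.card_eq_fintype_card, Fintype.card_sigma]
  simp only [card_vector, Fintype.card_bool]
  rw [Fin.sum_univ_eq_sum_range (fun i => 2 ^ i)]
  exact Nat.geomSum_lt le_rfl fun i hi => Finset.mem_range.mp hi

/-- The objects with a description of length at most `m` inject into the bitstrings of length
at most `m`. -/
theorem exists_injective_describable {Y : Type*} (d : List Bool → Option Y) (m : ℕ) :
    ∃ f : {y : Y // ∃ s : List Bool, d s = some y ∧ s.length ≤ m} →
      {s : List Bool // s.length ≤ m}, Function.Injective f := by
  choose f hf using fun y : {y : Y // ∃ s : List Bool, d s = some y ∧ s.length ≤ m} => y.property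
  refine ⟨fun y => ⟨f y, (hf y).2⟩, fun y z h => ?_⟩
  have hyz : f y = f z := congrArg Subtype.val h
  have hy := (hf y).1
  rw [hyz, (hf z).1] at hy
  exact Subtype.ext (Option.some.inj hy).symm

/-- For `x` drawn uniformly at random from the `2 ^ n` bitstrings of length `n`, and any
`k ≤ n`, the probability that the description complexity of `x` is at most `n - k` is at
most `2 ^ (1 - k)`. -/
theorem stmt_4 (n : ℕ) (d : List Bool → Option (List Bool)) (k : ℕ) (hk : k ≤ n) :
    (Nat.card {x : {l : List Bool // l.length = n} // ∃ s : List Bool,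
        d s = some x.val ∧ s.length ≤ n - k} : ℝ) / 2 ^ n
      ≤ (2 : ℝ) ^ ((1 : ℤ) - (k : ℤ)) := by
  obtain ⟨f, hf⟩ := exists_injective_describable d (n - k)
  have hcard : Nat.card {x : {l : List Bool // l.length = n} // ∃ s : List Bool,
      d s = some x.val ∧ s.length ≤ n - k} ≤ 2 ^ (n - k + 1) := by
    refine (Nat.card_le_card_of_injective (fun x => f ⟨x.val.val, x.property⟩)
      fun x y h => ?_).trans (card_boundedBitstring_lt (n - k)).le
    exact Subtype.ext (Subtype.ext (Subtype.mk.inj (hf h)))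
  rw [div_le_iff₀ (by positivity), ← zpow_natCast (2 : ℝ) n, ← zpow_add₀ two_ne_zero,
    show (1 : ℤ) - k + n = ((n - k + 1 : ℕ) : ℤ) by omega, zpow_natCast]
  exact_mod_cast hcard
end

section
/- (Kraft inequality) If S is a prefix-free set of bitstrings, then the sum over s ∈ S of 2^(−s.length) is at most 1 (the sum interpreted as a tsum over S, which in particular converges). -/
open scoped ENNReal

/-- A set of bitstrings is prefix-free if no element is a proper prefix of a different
element, i.e. any prefix relation within the set forces equality. -/
def PrefixFree (S : Set (List Bool)) : Prop :=
  ∀ s ∈ S, ∀ t ∈ S, s <+: t → s = t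

/-- A prefix-free set of nonempty bitstrings is uniquely decodable. -/
theorem PrefixFree.uniquelyDecodable {S : Set (List Bool)} (hS : PrefixFree S) (h : [] ∉ S) :
    InformationTheory.UniquelyDecodable S := by
  intro L₁
  induction L₁ with
  | nil =>
    rintro (_ | ⟨b, L₂⟩) _ h₂ hL
    · rfl
    · have hb : b = [] := by simp_all
      exact absurd (hb ▸ h₂ b (by simp)) h
  | cons a L₁ ih =>
    rintro (_ | ⟨b, L₂⟩) h₁ h₂ hL
    · have ha : a = [] := by simp_all
      exact absurd (ha ▸ h₁ a (by simp)) h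
    · have ha := h₁ a (by simp)
      have hb := h₂ b (by simp)
      rw [List.flatten_cons, List.flatten_cons] at hL
      have hab : a = b := by
        rcases List.prefix_or_prefix_of_prefix (List.prefix_append a L₁.flatten)
          (hL ▸ List.prefix_append b L₂.flatten) with hp | hp
        · exact hS a ha b hb hp
        · exact (hS b hb a ha hp).symm
      subst hab
      rw [ih L₂ (fun w hw => h₁ w (by simp [hw])) (fun w hw => h₂ w (by simp [hw]))
        (List.append_cancel_left hL)]

theorem PrefixFree.mono {S T : Set (List Bool)} (hS : PrefixFree S) (h : T ⊆ S) :
    PrefixFree T :=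
  fun s hs t ht => hS s (h hs) t (h ht)

theorem PrefixFree.sum_le_one {T : Finset (List Bool)} (hT : PrefixFree (T : Set (List Bool))) :
    ∑ s ∈ T, (2⁻¹ : ℝ) ^ s.length ≤ 1 := by
  by_cases h : [] ∈ T
  · have hT' : T = {[]} := Finset.eq_singleton_iff_unique_mem.2
      ⟨h, fun t ht => (hT [] (by simpa using h) t (by simpa using ht) List.nil_prefix).symm⟩
    simp [hT']
  · simpa using InformationTheory.kraft_mcmillan_inequality
      (hT.uniquelyDecodable (by simpa using h))

/-- Kraft inequality: if `S` is a prefix-free set of bitstrings, then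
`∑_{s ∈ S} 2 ^ (-|s|) ≤ 1`. -/
theorem stmt_5 (S : Set (List Bool)) (hS : PrefixFree S) :
    ∑' s : S, (2 : ℝ≥0∞) ^ (-(s.val.length : ℤ)) ≤ 1 := by
  rw [ENNReal.tsum_eq_iSup_sum]
  refine iSup_le fun F => ?_
  have hsub : (F.map (Function.Embedding.subtype _) : Set (List Bool)) ⊆ S := by
    intro s hs
    simp only [Finset.coe_map, Set.mem_image] at hs
    obtain ⟨t, -, rfl⟩ := hs
    exact t.2
  have hF := (hS.mono hsub).sum_le_one
  rw [Finset.sum_map] at hF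
  have hterm (s : S) : (2 : ℝ≥0∞) ^ (-(s.val.length : ℤ)) =
      ENNReal.ofReal ((2⁻¹ : ℝ) ^ s.val.length) := by
    rw [ENNReal.ofReal_pow (by norm_num), ENNReal.ofReal_inv_of_pos (by norm_num),
      ENNReal.zpow_neg, zpow_natCast, ENNReal.inv_pow]
    simp
  simp_rw [hterm]
  rw [← ENNReal.ofReal_sum_of_nonneg fun _ _ => by positivity]
  exact ENNReal.ofReal_le_one.2 hF
end

section
/- (Shannon code existence) Let A be a finite nonempty type and let q : A → ℝ satisfy q a > 0 for all a and ∑_a q a = 1. Then there exists an injective map E : A → List Bool whose range is a prefix-free set of bitstrings such that for every a, (E a).length ≤ ⌈log₂(1/q a)⌉ ≤ log₂(1/q a) + 1. -/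
/-- There are `2 ^ n` bitstrings of length `n`. -/
theorem exists_finset_bitstrings_length (n : ℕ) :
    ∃ W : Finset (List Bool), W.card = 2 ^ n ∧ ∀ w, w ∈ W ↔ w.length = n := by
  refine ⟨(Finset.univ : Finset (List.Vector Bool n)).map
    ⟨List.Vector.toList, List.Vector.toList_injective⟩, ?_, fun w => ?_⟩
  · rw [Finset.card_map, Finset.card_univ, card_vector, Fintype.card_bool]
  · simp only [Finset.mem_map, Finset.mem_univ, true_and, Function.Embedding.coeFn_mk]
    exact ⟨fun ⟨v, hv⟩ => hv ▸ v.toList_length, fun h => ⟨⟨w, h⟩, rfl⟩⟩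

/-- A family of bitstrings of length at most `n` whose cylinders do not exhaust the bitstrings
of length `n` leaves some bitstring of length `n` without a prefix in the family. -/
theorem exists_not_prefix_of_sum_lt {A : Type*} (s : Finset A) (E : A → List Bool) (n : ℕ)
    (h : ∑ b ∈ s, 2 ^ (n - (E b).length) < 2 ^ n) :
    ∃ w : List Bool, w.length = n ∧ ∀ b ∈ s, ¬ E b <+: w := by
  classical
  choose W hcard hmem using exists_finset_bitstrings_length
  let F : Finset (List Bool) := s.biUnion fun b => (W (n - (E b).length)).image (E b ++ ·)
  have hF : F.card < (W n).card := calc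
    F.card ≤ ∑ b ∈ s, ((W (n - (E b).length)).image (E b ++ ·)).card := Finset.card_biUnion_le
    _ ≤ ∑ b ∈ s, 2 ^ (n - (E b).length) :=
      Finset.sum_le_sum fun b _ => Finset.card_image_le.trans (hcard _).le
    _ < (W n).card := by rwa [hcard]
  obtain ⟨w, hw, hwF⟩ := Finset.exists_mem_notMem_of_card_lt_card hF
  rw [hmem] at hw
  refine ⟨w, hw, fun b hb ⟨t, ht⟩ => hwF ?_⟩
  refine Finset.mem_biUnion.2 ⟨b, hb, Finset.mem_image.2 ⟨t, (hmem _ _).2 ?_, ht⟩⟩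
  rw [← hw, ← ht, List.length_append, Nat.add_sub_cancel_left]

/-- Converse of Kraft's inequality: lengths satisfying it are those of a prefix-free code. -/
theorem exists_prefix_code_of_kraft {A : Type*} (l : A → ℕ) (s : Finset A)
    (h : ∑ a ∈ s, (1 / 2 : ℝ) ^ l a ≤ 1) :
    ∃ E : A → List Bool, (∀ a ∈ s, (E a).length = l a) ∧
      ∀ a ∈ s, ∀ b ∈ s, E a <+: E b → a = b := by
  classical
  induction s using Finset.induction_on_max_value l with
  | empty => exact ⟨fun _ => [], by simp, by simp⟩
  | insert a s ha hmax ih =>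
    rw [Finset.sum_insert ha] at h
    have hpos : (0 : ℝ) < (1 / 2) ^ l a := by positivity
    obtain ⟨E, hlen, hpre⟩ := ih (by linarith)
    have hlt : ∑ b ∈ s, 2 ^ (l a - (E b).length) < 2 ^ l a := by
      have hcast : ∑ b ∈ s, (2 : ℝ) ^ (l a - (E b).length)
          = 2 ^ l a * ∑ b ∈ s, (1 / 2 : ℝ) ^ l b := by
        rw [Finset.mul_sum]
        refine Finset.sum_congr rfl fun b hb => ?_
        rw [hlen b hb, pow_sub₀ _ two_ne_zero (hmax b hb), one_div, inv_pow]
      have hreal : ∑ b ∈ s, (2 : ℝ) ^ (l a - (E b).length) < 2 ^ l a := by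
        rw [hcast]
        exact mul_lt_of_lt_one_right (by positivity) (by linarith)
      exact_mod_cast hreal
    obtain ⟨w, hw, hnot⟩ := exists_not_prefix_of_sum_lt s E (l a) hlt
    have hne : ∀ b ∈ s, b ≠ a := fun b hb hba => ha (hba ▸ hb)
    refine ⟨Function.update E a w, fun b hb => ?_, fun b hb c hc hbc => ?_⟩
    · rcases Finset.mem_insert.1 hb with rfl | hb
      · simpa using hw
      · simpa [hne b hb] using hlen b hb
    · rcases Finset.mem_insert.1 hb with rfl | hbs <;> rcases Finset.mem_insert.1 hc with rfl | hcs
      · rfl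
      · rw [Function.update_self, Function.update_of_ne (hne c hcs)] at hbc
        have heq : w = E c :=
          hbc.eq_of_length_le (by rw [hw, hlen c hcs]; exact hmax c hcs)
        exact absurd (heq ▸ List.prefix_rfl) (hnot c hcs)
      · rw [Function.update_self, Function.update_of_ne (hne b hbs)] at hbc
        exact absurd hbc (hnot b hbs)
      · rw [Function.update_of_ne (hne b hbs), Function.update_of_ne (hne c hcs)] at hbc
        exact hpre b hbs c hcs hbc

/-- Shannon code existence: given a positive probability vector `q` on a finite nonempty
type `A`, there is an injective prefix-free encoding `E : A → List Bool` with
`|E a| ≤ ⌈log₂ (1 / q a)⌉ ≤ log₂ (1 / q a) + 1` for every `a`. -/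
theorem stmt_6 {A : Type*} [Fintype A] [Nonempty A] (q : A → ℝ)
    (hq : ∀ a, 0 < q a) (hsum : ∑ a, q a = 1) :
    ∃ E : A → List Bool, Function.Injective E ∧ PrefixFree (Set.range E) ∧
      ∀ a, ((E a).length : ℤ) ≤ ⌈Real.logb 2 (1 / q a)⌉ ∧
        (⌈Real.logb 2 (1 / q a)⌉ : ℝ) ≤ Real.logb 2 (1 / q a) + 1 := by
  have hlog : ∀ a, 0 ≤ Real.logb 2 (1 / q a) := fun a =>
    Real.logb_nonneg one_lt_two <| (one_le_div (hq a)).2 <|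
      hsum ▸ Finset.single_le_sum (fun b _ => (hq b).le) (Finset.mem_univ a)
  have hkraft : ∑ a, (1 / 2 : ℝ) ^ ⌈Real.logb 2 (1 / q a)⌉₊ ≤ 1 := by
    refine (Finset.sum_le_sum fun a _ => ?_).trans_eq hsum
    have hle : 1 / q a ≤ 2 ^ ⌈Real.logb 2 (1 / q a)⌉₊ := by
      rw [← Real.rpow_natCast, ← Real.logb_le_iff_le_rpow one_lt_two (one_div_pos.2 (hq a))]
      exact Nat.le_ceil _
    rw [one_div_pow]
    exact (one_div_le (hq a) (by positivity)).1 hle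
  obtain ⟨E, hlen, hpre⟩ := exists_prefix_code_of_kraft _ Finset.univ hkraft
  have hinj : ∀ a b, E a <+: E b → a = b := fun a b =>
    hpre a (Finset.mem_univ a) b (Finset.mem_univ b)
  refine ⟨E, fun a b hab => hinj a b (hab ▸ List.prefix_rfl), ?_, fun a => ⟨?_, ?_⟩⟩
  · rintro _ ⟨a, rfl⟩ _ ⟨b, rfl⟩ hab
    rw [hinj a b hab]
  · rw [hlen a (Finset.mem_univ a), Int.natCast_ceil_eq_ceil (hlog a)]
  · exact (Int.ceil_lt_add_one _).le
end

section
/- Let n ≥ 1 and C ≥ 2 be natural numbers and let p be a classifier on an n-point dataset with C classes such that p i c > 0 for all i and c. Then there exists an injective map E : (Fin n → Fin C) → List Bool whose range is a prefix-free set of bitstrings such that for every labeling y : Fin n → Fin C, (E y).length ≤ ∑_{i} log₂(1/(p i (y i))) + 1. In words, the labels of a dataset can be losslessly encoded using the likelihood model p with a number of bits bounded by the negative base-2 log-likelihood plus one. -/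
/-- Converse of the Kraft inequality: lengths whose Kraft sum is at most one are the codeword
lengths of a prefix code. -/
theorem exists_prefix_code_of_kraft_sum_le_one {ι : Type*} (l : ι → ℕ) (s : Finset ι)
    (h : ∑ i ∈ s, (1 / 2 : ℝ) ^ l i ≤ 1) :
    ∃ E : ι → List Bool, (∀ i ∈ s, (E i).length = l i) ∧
      ∀ i ∈ s, ∀ j ∈ s, E i <+: E j → i = j := by
  classical
  induction s using Finset.induction_on_max_value l with
  | empty => exact ⟨fun _ => [], by simp, by simp⟩
  | insert a s ha hmax ih =>
    rw [Finset.sum_insert ha] at h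
    have hlt : ∑ i ∈ s, (1 / 2 : ℝ) ^ l i < 1 := by
      have : (0 : ℝ) < (1 / 2) ^ l a := by positivity
      linarith
    obtain ⟨E, hlen, hE⟩ := ih hlt.le
    let words (k : ℕ) : Finset (List Bool) :=
      Finset.univ.image (List.Vector.toList : List.Vector Bool k → List Bool)
    have mem_words (k : ℕ) (w : List Bool) : w ∈ words k ↔ w.length = k := by
      simp only [words, Finset.mem_image, Finset.mem_univ, true_and]
      exact ⟨by rintro ⟨v, rfl⟩; exact v.toList_length, fun hw => ⟨⟨w, hw⟩, rfl⟩⟩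
    have card_words (k : ℕ) : (words k).card = 2 ^ k := by
      rw [Finset.card_image_of_injective _ List.Vector.toList_injective, Finset.card_univ,
        card_vector, Fintype.card_bool]
    let bad : Finset (List Bool) := s.biUnion fun i => (words (l a - l i)).image (E i ++ ·)
    have hcard : bad.card < (words (l a)).card := by
      have hle : bad.card ≤ ∑ i ∈ s, 2 ^ (l a - l i) :=
        Finset.card_biUnion_le.trans <| Finset.sum_le_sum fun i _ =>
          Finset.card_image_le.trans (card_words _).le
      have hsum : ((∑ i ∈ s, 2 ^ (l a - l i) : ℕ) : ℝ) = 2 ^ l a * ∑ i ∈ s, (1 / 2 : ℝ) ^ l i := by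
        push_cast
        rw [Finset.mul_sum]
        refine Finset.sum_congr rfl fun i hi => ?_
        rw [pow_sub₀ _ two_ne_zero (hmax i hi), one_div, inv_pow]
      have hlt' : ((∑ i ∈ s, 2 ^ (l a - l i) : ℕ) : ℝ) < ((2 ^ l a : ℕ) : ℝ) := by
        rw [hsum]
        push_cast
        exact mul_lt_of_lt_one_right (by positivity) hlt
      rw [card_words]
      exact hle.trans_lt (by exact_mod_cast hlt')
    obtain ⟨w, hw, hbad⟩ := Finset.exists_mem_notMem_of_card_lt_card hcard
    rw [mem_words] at hw
    have hpre : ∀ i ∈ s, ¬ E i <+: w := by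
      rintro i hi ⟨t, rfl⟩
      refine hbad (Finset.mem_biUnion.2 ⟨i, hi, Finset.mem_image.2 ⟨t, ?_, rfl⟩⟩)
      rw [mem_words]
      rw [List.length_append, hlen i hi] at hw
      omega
    have hpre' : ∀ i ∈ s, ¬ w <+: E i := by
      intro i hi hwi
      have hlen_le : (E i).length ≤ w.length := by
        rw [hlen i hi, hw]
        exact hmax i hi
      have heq : w = E i := hwi.eq_of_length_le hlen_le
      exact hpre i hi (heq ▸ List.prefix_refl _)
    have hne : ∀ i ∈ s, i ≠ a := fun i hi hia => ha (hia ▸ hi)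
    refine ⟨Function.update E a w, ?_, ?_⟩
    · intro i hi
      rcases Finset.mem_insert.1 hi with rfl | hi
      · simpa using hw
      · simpa [hne i hi] using hlen i hi
    · intro i hi j hj hij
      rcases Finset.mem_insert.1 hi with rfl | his <;> rcases Finset.mem_insert.1 hj with rfl | hjs
      · rfl
      · exact (hpre' j hjs (by simpa [hne j hjs] using hij)).elim
      · exact (hpre i his (by simpa [hne i his] using hij)).elim
      · exact hE i his j hjs (by simpa [hne i his, hne j hjs] using hij)

/-- The labels of an `n`-point dataset with `C` classes can be losslessly encoded using a
strictly positive likelihood model `p` by an injective prefix-free code whose length on a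
labeling `y` is at most the negative base-2 log-likelihood `∑ᵢ log₂ (1 / p i (y i))`
plus one. -/
theorem stmt_7 (n C : ℕ) (hn : 1 ≤ n) (hC : 2 ≤ C) (p : Fin n → Fin C → ℝ)
    (hpos : ∀ i c, 0 < p i c) (hsum : ∀ i, ∑ c, p i c = 1) :
    ∃ E : (Fin n → Fin C) → List Bool, Function.Injective E ∧ PrefixFree (Set.range E) ∧
      ∀ y : Fin n → Fin C,
        ((E y).length : ℝ) ≤ (∑ i, Real.logb 2 (1 / p i (y i))) + 1 := by
  have hP (y : Fin n → Fin C) : 0 < ∏ i, p i (y i) := Finset.prod_pos fun i _ => hpos i (y i)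
  have hle_one (i : Fin n) (c : Fin C) : p i c ≤ 1 :=
    hsum i ▸ Finset.single_le_sum (fun d _ => (hpos i d).le) (Finset.mem_univ c)
  have hlog (y : Fin n → Fin C) :
      ∑ i, Real.logb 2 (1 / p i (y i)) = -Real.logb 2 (∏ i, p i (y i)) := by
    rw [Real.logb_prod _ _ fun i _ => (hpos i (y i)).ne', ← Finset.sum_neg_distrib]
    simp only [one_div, Real.logb_inv]
  have hnonneg (y : Fin n → Fin C) : 0 ≤ ∑ i, Real.logb 2 (1 / p i (y i)) :=
    Finset.sum_nonneg fun i _ =>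
      Real.logb_nonneg one_lt_two (one_le_one_div (hpos i (y i)) (hle_one i (y i)))
  have htotal : ∑ y : Fin n → Fin C, ∏ i, p i (y i) = 1 := by
    rw [← Fintype.prod_sum]
    simp [hsum]
  let l (y : Fin n → Fin C) : ℕ := ⌈∑ i, Real.logb 2 (1 / p i (y i))⌉₊
  have hkraft : ∑ y, (1 / 2 : ℝ) ^ l y ≤ 1 := by
    refine le_of_le_of_eq ?_ htotal
    refine Finset.sum_le_sum fun y _ => ?_
    have hceil : -Real.logb 2 (∏ i, p i (y i)) ≤ l y := hlog y ▸ Nat.le_ceil _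
    calc (1 / 2 : ℝ) ^ l y = 2 ^ (-(l y : ℝ)) := by
          rw [Real.rpow_neg zero_le_two, Real.rpow_natCast, one_div, inv_pow]
      _ ≤ 2 ^ Real.logb 2 (∏ i, p i (y i)) :=
          Real.rpow_le_rpow_of_exponent_le one_le_two (by linarith)
      _ = ∏ i, p i (y i) := Real.rpow_logb two_pos (by norm_num) (hP y)
  obtain ⟨E, hlen, hE⟩ := exists_prefix_code_of_kraft_sum_le_one l Finset.univ hkraft
  have hE' (y z : Fin n → Fin C) (h : E y <+: E z) : y = z :=
    hE y (Finset.mem_univ y) z (Finset.mem_univ z) h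
  refine ⟨E, fun y z h => hE' y z (h ▸ List.prefix_refl _), ?_, fun y => ?_⟩
  · rintro _ ⟨y, rfl⟩ _ ⟨z, rfl⟩ h
    rw [hE' y z h]
  · rw [hlen y (Finset.mem_univ y)]
    exact (Nat.ceil_lt_add_one (hnonneg y)).le
end

section
/- Let n ≥ 1 and C ≥ 2 be natural numbers, let p be a classifier on an n-point dataset with C classes, and let y : Fin n → Fin C be drawn from the uniform distribution on labelings. Then for every ε > 0, the probability that CE(p, y) ≤ ln C − ε is at most exp(−n·ε). In particular, for a single fixed classifier, achieving empirical cross entropy appreciably below that of a uniform random guess on uniformly random labels is exponentially unlikely in n. -/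
open Finset in
/-- Markov-type bound: at most `1 / a` labelings have likelihood at least `a` under a fixed
classifier. -/
theorem card_mul_le_one_of_le_prod {ι κ : Type*} [Fintype ι] [DecidableEq ι] [Fintype κ]
    (p : ι → κ → ℝ) (hnn : ∀ i c, 0 ≤ p i c) (hsum : ∀ i, ∑ c, p i c = 1)
    (a : ℝ) (S : Finset (ι → κ)) (hS : ∀ y ∈ S, a ≤ ∏ i, p i (y i)) :
    (#S : ℝ) * a ≤ 1 := by
  calc (#S : ℝ) * a = ∑ _y ∈ S, a := by simp
    _ ≤ ∑ y ∈ S, ∏ i, p i (y i) := sum_le_sum hS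
    _ ≤ ∑ y : ι → κ, ∏ i, p i (y i) :=
        sum_le_univ_sum_of_nonneg fun y => prod_nonneg fun i _ => hnn i (y i)
    _ = ∏ i, ∑ c, p i c := (Fintype.prod_sum p).symm
    _ = 1 := by simp [hsum]

/-- A labeling of cross entropy at most `L` has likelihood at least `exp (-n * L)`. -/
theorem exp_le_prod_of_crossEntropy_le {n : ℕ} (hn : 1 ≤ n) (q : Fin n → ℝ)
    (hnn : ∀ i, 0 ≤ q i) (hq : ∀ i, q i ≠ 0) (L : ℝ)
    (h : -(1 / (n : ℝ)) * ∑ i, Real.log (q i) ≤ L) :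
    Real.exp (-(n * L)) ≤ ∏ i, q i := by
  have hn' : (0 : ℝ) < n := by exact_mod_cast hn
  have hlog : -(n * L) ≤ ∑ i, Real.log (q i) := by
    have := mul_le_mul_of_nonneg_left h hn'.le
    field_simp at this
    linarith
  calc Real.exp (-(n * L)) ≤ Real.exp (∑ i, Real.log (q i)) := Real.exp_le_exp.mpr hlog
    _ = ∏ i, q i := by
        rw [Real.exp_sum]
        exact Finset.prod_congr rfl fun i _ => Real.exp_log ((hnn i).lt_of_ne' (hq i))

/-- For a fixed classifier `p` on an `n`-point dataset with `C` classes and uniformly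
random labels `y`, the probability that the empirical cross entropy
`CE(p, y) = -(1/n) ∑ᵢ log (p i (y i))` is at most `ln C - ε` is at most `exp (-n·ε)`.
(With the convention `CE = ∞` when some `p i (y i) = 0`, the event additionally requires
all `p i (y i)` to be nonzero.) -/
theorem stmt_9 (n C : ℕ) (hn : 1 ≤ n) (hC : 2 ≤ C) (p : Fin n → Fin C → ℝ)
    (hnn : ∀ i c, 0 ≤ p i c) (hsum : ∀ i, ∑ c, p i c = 1) (ε : ℝ) (hε : 0 < ε) :
    (Nat.card {y : Fin n → Fin C // (∀ i, p i (y i) ≠ 0) ∧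
        -(1 / (n : ℝ)) * ∑ i, Real.log (p i (y i)) ≤ Real.log C - ε} : ℝ) / (C : ℝ) ^ n
      ≤ Real.exp (-((n : ℝ) * ε)) := by
  classical
  have hC' : (0 : ℝ) < C := by positivity
  have hexp : Real.exp (-(n * (Real.log C - ε))) = Real.exp (n * ε) / (C : ℝ) ^ n := by
    rw [show -(n * (Real.log C - ε)) = n * ε - n * Real.log C by ring, Real.exp_sub,
      Real.exp_nat_mul (Real.log C), Real.exp_log hC']
  rw [Nat.card_eq_fintype_card, Fintype.card_subtype, Real.exp_neg, ← one_div,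
    le_div_iff₀ (Real.exp_pos _), div_mul_eq_mul_div, mul_div_assoc, ← hexp]
  refine card_mul_le_one_of_le_prod p hnn hsum _ _ fun y hy => ?_
  obtain ⟨hne, hle⟩ := (Finset.mem_filter.mp hy).2
  exact exp_le_prod_of_crossEntropy_le hn _ (fun i => hnn i (y i)) hne _ hle
end

section
/- (No free lunch theorem via description complexity, plain-description form) Let n ≥ 1 and C ≥ 2 be natural numbers, let d be any description system assigning to bitstrings classifiers on an n-point dataset with C classes, let δ ∈ (0, 1], and let y : Fin n → Fin C be drawn from the uniform distribution on labelings. Then with probability at least 1 − δ, simultaneously for every bitstring s and every classifier p with d s = some p, CE(p, y) ≥ ln C − (ln 2 / n) · (s.length + 2 · log₂(s.length + 1) + log₂(1/δ) + 1). Thus for any classifier of bounded description length, if n is large enough, its cross entropy on uniformly random labels cannot be appreciably smaller than that of a uniform random guess. -/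
lemma sum_range_inv_succ_sq_le (N : ℕ) :
    ∑ L ∈ Finset.range N, 1 / ((L : ℝ) + 1) ^ 2 ≤ 2 - 1 / (N : ℝ) := by
  induction N with
  | zero => simp
  | succ N ih =>
    rw [Finset.sum_range_succ]
    rcases Nat.eq_zero_or_pos N with rfl | hN
    · norm_num
    · have hN' : (0 : ℝ) < N := by exact_mod_cast hN
      have key : 1 / ((N : ℝ) + 1) ^ 2 ≤ 1 / (N : ℝ) - 1 / ((N : ℝ) + 1) := by
        rw [div_sub_div _ _ (by positivity) (by positivity),
          div_le_div_iff₀ (by positivity) (by positivity)]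
        nlinarith
      push_cast
      linarith

lemma card_filter_length_eq_le (S : Finset (List Bool)) (L : ℕ) :
    (S.filter fun s => s.length = L).card ≤ 2 ^ L := by
  have h : (S.filter fun s => s.length = L) ⊆
      (Finset.univ : Finset (List.Vector Bool L)).image List.Vector.toList := by
    intro s hs
    rw [Finset.mem_image]
    exact ⟨⟨s, (Finset.mem_filter.1 hs).2⟩, Finset.mem_univ _, rfl⟩
  calc _ ≤ _ := Finset.card_le_card h
    _ ≤ _ := Finset.card_image_le
    _ = 2 ^ L := by simp

/-- The weights `2 ^ (-|s|) / (2 (|s| + 1) ^ 2)` on bitstrings form a subprobability. -/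
lemma sum_bitstring_weight_le_one (S : Finset (List Bool)) :
    ∑ s ∈ S, 1 / ((2 : ℝ) ^ s.length * ((s.length : ℝ) + 1) ^ 2 * 2) ≤ 1 := by
  obtain ⟨N, hN⟩ : ∃ N, ∀ s ∈ S, s.length ∈ Finset.range N :=
    ⟨S.sup List.length + 1, fun s hs => Finset.mem_range.2
      (Nat.lt_succ_of_le (Finset.le_sup (f := List.length) hs))⟩
  rw [← Finset.sum_fiberwise_of_maps_to hN]
  calc _ ≤ ∑ L ∈ Finset.range N, (1 / ((L : ℝ) + 1) ^ 2) * (1 / 2) := by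
        refine Finset.sum_le_sum fun L _ => ?_
        have h : ∀ s ∈ S.filter (fun s => s.length = L),
            1 / ((2 : ℝ) ^ s.length * ((s.length : ℝ) + 1) ^ 2 * 2)
              = 1 / ((2 : ℝ) ^ L * ((L : ℝ) + 1) ^ 2 * 2) := by
          intro s hs
          rw [(Finset.mem_filter.1 hs).2]
        rw [Finset.sum_congr rfl h, Finset.sum_const, nsmul_eq_mul]
        have hc : ((S.filter fun s => s.length = L).card : ℝ) ≤ 2 ^ L := by
          exact_mod_cast card_filter_length_eq_le S L
        calc _ ≤ (2 : ℝ) ^ L * (1 / ((2 : ℝ) ^ L * ((L : ℝ) + 1) ^ 2 * 2)) := by gcongr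
          _ = _ := by field_simp
    _ ≤ 1 := by
        rw [← Finset.sum_mul]
        have h1 := sum_range_inv_succ_sq_le N
        have h2 : (0 : ℝ) ≤ 1 / (N : ℝ) := by positivity
        linarith

/-- Markov's inequality for the likelihood of a classifier over all labelings. -/
lemma card_mul_le_one_of_le_likelihood {ι κ : Type*} [Fintype ι] [DecidableEq ι] [Fintype κ]
    (p : ι → κ → ℝ) (h0 : ∀ i c, 0 ≤ p i c) (h1 : ∀ i, ∑ c, p i c = 1)
    (A : Finset (ι → κ)) (t : ℝ) (hA : ∀ y ∈ A, t ≤ ∏ i, p i (y i)) :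
    A.card * t ≤ 1 := by
  calc (A.card : ℝ) * t = ∑ _y ∈ A, t := by simp
    _ ≤ ∑ y ∈ A, ∏ i, p i (y i) := Finset.sum_le_sum hA
    _ ≤ ∑ y : ι → κ, ∏ i, p i (y i) :=
        Finset.sum_le_sum_of_subset_of_nonneg (Finset.subset_univ _)
          fun y _ _ => Finset.prod_nonneg fun i _ => h0 i _
    _ = ∏ i, ∑ c, p i c := (Fintype.prod_sum p).symm
    _ = 1 := by simp [h1]

/-- A labeling whose cross entropy violates the description length bound is likely. -/
lemma le_likelihood_of_crossEntropy_lt {n C : ℕ} (hn : 1 ≤ n) (hC : 1 ≤ C) {δ : ℝ} (hδ : 0 < δ)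
    (L : ℕ) (q : Fin n → ℝ) (hq : ∀ i, 0 < q i)
    (h : -(1 / (n : ℝ)) * ∑ i, Real.log (q i) < Real.log C - (Real.log 2 / (n : ℝ)) *
      ((L : ℝ) + 2 * Real.logb 2 ((L : ℝ) + 1) + Real.logb 2 (1 / δ) + 1)) :
    (2 : ℝ) ^ L * ((L : ℝ) + 1) ^ 2 * 2 / (δ * (C : ℝ) ^ n) ≤ ∏ i, q i := by
  have hn' : (0 : ℝ) < n := by exact_mod_cast hn
  have hC' : (0 : ℝ) < C := by exact_mod_cast hC
  have hL : (0 : ℝ) < (L : ℝ) + 1 := by positivity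
  have h2 : Real.log 2 ≠ 0 := (Real.log_pos one_lt_two).ne'
  rw [← Real.log_le_log_iff (by positivity) (Finset.prod_pos fun i _ => hq i),
    Real.log_prod fun i _ => (hq i).ne', Real.log_div (by positivity) (by positivity),
    Real.log_mul (by positivity) (by positivity), Real.log_mul (by positivity) (by positivity),
    Real.log_mul (by positivity) (by positivity), Real.log_pow, Real.log_pow, Real.log_pow]
  have h' := mul_lt_mul_of_pos_left h hn'
  have e1 : (n : ℝ) * (-(1 / (n : ℝ)) * ∑ i, Real.log (q i)) = -∑ i, Real.log (q i) := by
    field_simp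
  have e2 : (n : ℝ) * (Real.log C - (Real.log 2 / (n : ℝ)) *
      ((L : ℝ) + 2 * Real.logb 2 ((L : ℝ) + 1) + Real.logb 2 (1 / δ) + 1))
      = n * Real.log C - (L * Real.log 2 + 2 * Real.log ((L : ℝ) + 1) - Real.log δ
        + Real.log 2) := by
    simp only [Real.logb, one_div, Real.log_inv]
    field_simp
    ring
  rw [e1, e2] at h'
  push_cast
  linarith

/-- No free lunch via description complexity (plain-description form): for any description
system `d` assigning classifiers to bitstrings, with probability at least `1 - δ` over
uniformly random labelings `y`, simultaneously for every bitstring `s` describing a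
classifier `p`, the empirical cross entropy `CE(p, y) = -(1/n) ∑ᵢ log (p i (y i))`
(equal to `∞` if some `p i (y i) = 0`, in which case the bound is trivial) is at least
`ln C - (ln 2 / n)·(|s| + 2·log₂(|s| + 1) + log₂(1/δ) + 1)`. -/
theorem stmt_10 (n C : ℕ) (hn : 1 ≤ n) (hC : 2 ≤ C)
    (d : List Bool → Option (Fin n → Fin C → ℝ)) (δ : ℝ) (hδ0 : 0 < δ) (hδ1 : δ ≤ 1) :
    1 - δ ≤ (Nat.card {y : Fin n → Fin C // ∀ (s : List Bool) (p : Fin n → Fin C → ℝ),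
        d s = some p → (∀ i c, 0 ≤ p i c) → (∀ i, ∑ c, p i c = 1) →
        (∀ i, p i (y i) ≠ 0) →
        Real.log C - (Real.log 2 / (n : ℝ)) *
            ((s.length : ℝ) + 2 * Real.logb 2 ((s.length : ℝ) + 1)
              + Real.logb 2 (1 / δ) + 1)
          ≤ -(1 / (n : ℝ)) * ∑ i, Real.log (p i (y i))} : ℝ) / (C : ℝ) ^ n := by
  classical
  set P : (Fin n → Fin C) → Prop := fun y => ∀ (s : List Bool) (p : Fin n → Fin C → ℝ),
    d s = some p → (∀ i c, 0 ≤ p i c) → (∀ i, ∑ c, p i c = 1) →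
    (∀ i, p i (y i) ≠ 0) →
    Real.log C - (Real.log 2 / (n : ℝ)) *
        ((s.length : ℝ) + 2 * Real.logb 2 ((s.length : ℝ) + 1)
          + Real.logb 2 (1 / δ) + 1)
      ≤ -(1 / (n : ℝ)) * ∑ i, Real.log (p i (y i)) with hP
  have hCn : (0 : ℝ) < (C : ℝ) ^ n := by positivity
  set B : Finset (Fin n → Fin C) := Finset.univ.filter fun y => ¬ P y with hB
  have hbad : ∀ y, ∃ s : List Bool, y ∈ B → ∃ p, d s = some p ∧ (∀ i c, 0 ≤ p i c) ∧
      (∀ i, ∑ c, p i c = 1) ∧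
      (2 : ℝ) ^ s.length * ((s.length : ℝ) + 1) ^ 2 * 2 / (δ * (C : ℝ) ^ n)
        ≤ ∏ i, p i (y i) := by
    intro y
    by_cases hy : y ∈ B
    · have hy' := (Finset.mem_filter.1 hy).2
      simp only [hP] at hy'
      push Not at hy'
      obtain ⟨s, p, hd, h0, h1, hne, hlt⟩ := hy'
      exact ⟨s, fun _ => ⟨p, hd, h0, h1, le_likelihood_of_crossEntropy_lt hn (by omega) hδ0 _ _
        (fun i => lt_of_le_of_ne (h0 i _) (hne i).symm) hlt⟩⟩
    · exact ⟨[], fun h => absurd h hy⟩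
  choose f hf using hbad
  have hfiber : ∀ s, ((B.filter fun y => f y = s).card : ℝ) ≤
      (δ * (C : ℝ) ^ n) * (1 / ((2 : ℝ) ^ s.length * ((s.length : ℝ) + 1) ^ 2 * 2)) := by
    intro s
    rcases (B.filter fun y => f y = s).eq_empty_or_nonempty with he | ⟨y₀, hy₀⟩
    · rw [he]
      simp only [Finset.card_empty, Nat.cast_zero]
      positivity
    · obtain ⟨hy₀B, rfl⟩ := Finset.mem_filter.1 hy₀
      obtain ⟨p, hd, h0, h1, -⟩ := hf y₀ hy₀B
      have := card_mul_le_one_of_le_likelihood p h0 h1 (B.filter fun y => f y = f y₀)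
        ((2 : ℝ) ^ (f y₀).length * (((f y₀).length : ℝ) + 1) ^ 2 * 2 / (δ * (C : ℝ) ^ n))
        (by
          intro y hy
          obtain ⟨hyB, hyf⟩ := Finset.mem_filter.1 hy
          obtain ⟨p', hd', -, -, hle⟩ := hf y hyB
          rw [hyf] at hd' hle
          obtain rfl : p = p' := Option.some.inj (hd.symm.trans hd')
          exact hle)
      rw [← mul_div_assoc, div_le_one (by positivity)] at this
      rw [mul_one_div, le_div_iff₀ (by positivity)]
      exact this
  have hBcard : (B.card : ℝ) ≤ δ * (C : ℝ) ^ n := by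
    rw [Finset.card_eq_sum_card_image f B]
    push_cast
    calc _ ≤ _ := Finset.sum_le_sum fun s _ => hfiber s
      _ ≤ (δ * (C : ℝ) ^ n) * 1 := by
        rw [← Finset.mul_sum]
        exact mul_le_mul_of_nonneg_left (sum_bitstring_weight_le_one _) (by positivity)
      _ = _ := mul_one _
  have hgood : (Nat.card {y // P y} : ℝ) + B.card = (C : ℝ) ^ n := by
    rw [Nat.card_eq_fintype_card, Fintype.card_subtype, hB]
    have := Finset.card_filter_add_card_filter_not (s := Finset.univ) P
    rw [Finset.card_univ, Fintype.card_fun, Fintype.card_fin, Fintype.card_fin] at this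
    exact_mod_cast this
  rw [le_div_iff₀ hCn]
  linarith
end

section
/- (Occam / finite hypothesis bound with a prior) Let Z be a measurable space, μ a probability measure on Z, H a countable type of hypotheses, ℓ : H → Z → ℝ a loss function measurable in z with 0 ≤ ℓ h z ≤ 1 for all h and z, and π : H → ℝ a prior with π h ≥ 0 and ∑_h π h ≤ 1. Fix n ≥ 1 and δ ∈ (0, 1]. Then with probability at least 1 − δ over a sample z = (z_1, …, z_n) drawn from the n-fold product measure μ^n, simultaneously for every hypothesis h with π h > 0, R(h) ≤ R̂(h, z) + √((ln(1/π h) + ln(1/δ)) / (2n)). -/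
open MeasureTheory

/-- One-sided Hoeffding bound for the empirical mean of a `[0, 1]`-valued function under a
product measure. -/
theorem measureReal_pi_integral_sub_mean_ge_le {Z : Type*} [MeasurableSpace Z] (μ : Measure Z)
    [IsProbabilityMeasure μ] {f : Z → ℝ} (hf : Measurable f) (hf01 : ∀ z, 0 ≤ f z ∧ f z ≤ 1)
    {n : ℕ} (hn : 1 ≤ n) {ε : ℝ} (hε : 0 ≤ ε) :
    (Measure.pi fun _ : Fin n => μ).real
        {z | (1 / (n : ℝ)) * ∑ i, f (z i) + ε ≤ ∫ x, f x ∂μ} ≤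
      Real.exp (-(2 * n * ε ^ 2)) := by
  have hn0 : (0 : ℝ) < n := by exact_mod_cast hn
  have hsub : ProbabilityTheory.HasSubgaussianMGF (fun x => ∫ y, f y ∂μ - f x)
      ((‖(0 : ℝ) - (-1)‖₊ / 2) ^ 2) μ := by
    have h := ProbabilityTheory.hasSubgaussianMGF_of_mem_Icc (μ := μ) (X := fun x => -f x)
      (a := -1) (b := 0) hf.neg.aemeasurable
      (Filter.Eventually.of_forall fun x => ⟨by linarith [(hf01 x).2], by linarith [(hf01 x).1]⟩)
    refine h.congr (Filter.Eventually.of_forall fun x => ?_)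
    simp only [integral_neg]
    ring
  have hmeas : Measurable fun x => ∫ y, f y ∂μ - f x := measurable_const.sub hf
  have hindep : ProbabilityTheory.iIndepFun
      (fun (i : Fin n) (z : Fin n → Z) => ∫ y, f y ∂μ - f (z i)) (Measure.pi fun _ => μ) :=
    ProbabilityTheory.iIndepFun_pi fun _ => hmeas.aemeasurable
  have hsub' (i : Fin n) : ProbabilityTheory.HasSubgaussianMGF
      (fun z : Fin n → Z => ∫ y, f y ∂μ - f (z i))
      ((‖(0 : ℝ) - (-1)‖₊ / 2) ^ 2) (Measure.pi fun _ : Fin n => μ) := by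
    refine ProbabilityTheory.HasSubgaussianMGF.of_map (Y := fun z : Fin n → Z => z i)
      (X := fun x => ∫ y, f y ∂μ - f x) (measurable_pi_apply i).aemeasurable ?_
    rwa [(measurePreserving_eval (fun _ : Fin n => μ) i).map_eq]
  have h := ProbabilityTheory.HasSubgaussianMGF.measure_sum_ge_le_of_iIndepFun hindep
    (s := Finset.univ) (fun i _ => hsub' i) (ε := n * ε) (by positivity)
  convert h using 2
  · congr 1
    ext z
    simp only [Finset.sum_sub_distrib, Finset.sum_const, Finset.card_univ,
      Fintype.card_fin, nsmul_eq_mul]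
    rw [← mul_le_mul_iff_right₀ hn0, mul_add, ← mul_assoc, mul_one_div_cancel hn0.ne', one_mul]
    constructor <;> intro _ <;> linarith
  · simp
    field_simp

/-- Occam / finite hypothesis bound with a prior: for a countable hypothesis class `H`
with prior `π` (nonnegative, summing to at most 1) and a `[0, 1]`-valued loss `ℓ`, with
probability at least `1 - δ` over an i.i.d. sample `z` of size `n` from `μ`,
simultaneously every hypothesis `h` with `π h > 0` satisfies
`R(h) ≤ R̂(h, z) + √((ln (1 / π h) + ln (1 / δ)) / (2n))`. -/
theorem stmt_12 {Z : Type*} [MeasurableSpace Z] (μ : Measure Z)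
    [IsProbabilityMeasure μ] {H : Type*} [Countable H]
    (ℓ : H → Z → ℝ) (hmeas : ∀ h, Measurable (ℓ h))
    (hbound : ∀ h z, 0 ≤ ℓ h z ∧ ℓ h z ≤ 1)
    (π : H → ℝ) (hπ : ∀ h, 0 ≤ π h) (hπsum : Summable π) (hπ1 : ∑' h, π h ≤ 1)
    (n : ℕ) (hn : 1 ≤ n) (δ : ℝ) (hδ0 : 0 < δ) (hδ1 : δ ≤ 1) :
    ENNReal.ofReal (1 - δ) ≤
      (Measure.pi fun _ : Fin n => μ)
        {z : Fin n → Z | ∀ h : H, 0 < π h →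
          ∫ x, ℓ h x ∂μ ≤ (1 / (n : ℝ)) * ∑ i, ℓ h (z i) +
            Real.sqrt ((Real.log (1 / π h) + Real.log (1 / δ)) / (2 * (n : ℝ)))} := by
  have hδ : 0 ≤ Real.log (1 / δ) := Real.log_nonneg (by rwa [le_div_iff₀ hδ0, one_mul])
  have hn0 : (0 : ℝ) < n := by exact_mod_cast hn
  set P := Measure.pi fun _ : Fin n => μ
  set r : H → ℝ := fun h => Real.sqrt ((Real.log (1 / π h) + Real.log (1 / δ)) / (2 * (n : ℝ)))
  set B : H → Set (Fin n → Z) := fun h =>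
    {z | 0 < π h ∧ (1 / (n : ℝ)) * ∑ i, ℓ h (z i) + r h < ∫ x, ℓ h x ∂μ}
  have hB (h : H) : P (B h) ≤ ENNReal.ofReal (π h * δ) := by
    rcases (hπ h).eq_or_lt with h0 | hpos
    · simp [B, ← h0]
    have hle : π h ≤ 1 := (hπsum.le_tsum h fun j _ => hπ j).trans hπ1
    have hlog : 0 ≤ Real.log (1 / π h) :=
      Real.log_nonneg (by rwa [le_div_iff₀ hpos, one_mul])
    have key := measureReal_pi_integral_sub_mean_ge_le μ (hmeas h) (hbound h) hn
      (ε := r h) (Real.sqrt_nonneg _)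
    have hexp : Real.exp (-(2 * n * r h ^ 2)) = π h * δ := by
      rw [Real.sq_sqrt (by positivity), mul_div_cancel₀ _ (by positivity), neg_add,
        Real.exp_add, one_div, one_div, Real.log_inv, Real.log_inv, neg_neg, neg_neg,
        Real.exp_log hpos, Real.exp_log hδ0]
    rw [hexp] at key
    refine (measure_mono fun z hz => hz.2.le).trans
      ((ENNReal.le_ofReal_iff_toReal_le (measure_ne_top _ _) (by positivity)).2 key)
  have hunion : P (⋃ h, B h) ≤ ENNReal.ofReal δ := by
    refine (measure_iUnion_le B).trans ((ENNReal.tsum_le_tsum hB).trans ?_)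
    rw [← ENNReal.ofReal_tsum_of_nonneg (fun h => mul_nonneg (hπ h) hδ0.le) (hπsum.mul_right δ),
      tsum_mul_right]
    exact ENNReal.ofReal_le_ofReal (mul_le_of_le_one_left hδ0.le hπ1)
  rw [ENNReal.ofReal_sub _ hδ0.le, ENNReal.ofReal_one, tsub_le_iff_right,
    ← measure_univ (μ := P)]
  refine (measure_mono fun z _ => ?_).trans ((measure_union_le _ (⋃ h, B h)).trans
    (add_le_add_right hunion _))
  by_cases hz : z ∈ ⋃ h, B h
  · exact Or.inr hz
  · refine Or.inl fun h hpos => not_lt.1 fun hlt => hz (Set.mem_iUnion.2 ⟨h, hpos, hlt⟩)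
end
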